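/- There exist constants c > 0, c' > 0 and d₀ such that the following holds for all d ≥ d₀ and κ ≥ 10. Let h ≤ c/(κ·log d), let f_hard(x) = (1/2)x₁² + ∑_{i=2}^d ((κ/3)x_i² − (κh/3)cos(x_i/√h)), and let Ω_hard = {x ∈ ℝ^d : |x₁| ≤ 2, and for each 2 ≤ i ≤ d there exists an integer k_i with |k_i| ≤ ⌊5/(π√(hκ))⌋ such that −(9/20)π√h + 2πk_i√h ≤ x_i ≤ (9/20)π√h + 2πk_i√h}. For any x ∈ Ω_hard, let y = x − h∇f_hard(x) + √(2h)·g with g ∼ N(0, I_d). Then with probability at least 1 − 2d⁻⁵ over g: f_hard(x) − f_hard(y) + (1/(4h))(‖y − (x − h∇f_hard(x))‖² − ‖x − (y − h∇f_hard(y))‖²) ≤ −c'·h·κ·d. -/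

import Mathlib

open MeasureTheory

noncomputable section

/-- The standard Gaussian `N(0, I_d)` on `Fin d → ℝ`. -/
def stdGaussianPi (d : ℕ) : Measure (Fin d → ℝ) :=
  Measure.pi fun _ : Fin d => ProbabilityTheory.gaussianReal 0 1

/-- Squared Euclidean norm on `ℝ^d`. -/
def sqNorm {d : ℕ} (z : Fin d → ℝ) : ℝ := ∑ i, z i ^ 2

/-- The coordinate functions of the hard distribution: `f₁(c) = c²/2` and
`fᵢ(c) = (κ/3)c² − (κh/3)cos(c/√h)` for `i ≠ 1`. -/
def fhard1d {d : ℕ} [NeZero d] (κ h : ℝ) (i : Fin d) : ℝ → ℝ :=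
  fun c => if i = 0 then (1 / 2) * c ^ 2
    else (κ / 3) * c ^ 2 - (κ * h / 3) * Real.cos (c / Real.sqrt h)

/-- The hard separable function `f_hard(x) = ∑ᵢ fᵢ(xᵢ)`. -/
def fhard {d : ℕ} [NeZero d] (κ h : ℝ) (x : Fin d → ℝ) : ℝ := ∑ i, fhard1d κ h i (x i)

/-- The gradient of `f_hard` (computed coordinatewise). -/
def gradFhard {d : ℕ} [NeZero d] (κ h : ℝ) (z : Fin d → ℝ) : Fin d → ℝ :=
  fun i => deriv (fhard1d κ h i) (z i)

/-- The bad set `Ω_hard`. -/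
def OmegaHard (d : ℕ) [NeZero d] (κ h : ℝ) : Set (Fin d → ℝ) :=
  {x | |x 0| ≤ 2 ∧ ∀ i : Fin d, i ≠ 0 → ∃ k : ℤ,
    |k| ≤ ⌊5 / (Real.pi * Real.sqrt (h * κ))⌋ ∧
    -(9 / 20) * Real.pi * Real.sqrt h + 2 * Real.pi * k * Real.sqrt h ≤ x i ∧
    x i ≤ (9 / 20) * Real.pi * Real.sqrt h + 2 * Real.pi * k * Real.sqrt h}

/-- The MALA proposal for the target `f_hard`: `y = x − h∇f_hard(x) + √(2h)·g`. -/
def malaY {d : ℕ} [NeZero d] (κ h : ℝ) (x g : Fin d → ℝ) : Fin d → ℝ :=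
  x - h • gradFhard κ h x + Real.sqrt (2 * h) • g

/-- The log-acceptance ratio of MALA with step size `h` targeting `∝ exp(−f_hard)`. -/
def logAccept {d : ℕ} [NeZero d] (κ h : ℝ) (x g : Fin d → ℝ) : ℝ :=
  fhard κ h x - fhard κ h (malaY κ h x g) +
    (1 / (4 * h)) *
      (sqNorm (malaY κ h x g - (x - h • gradFhard κ h x)) -
        sqNorm (x - (malaY κ h x g - h • gradFhard κ h (malaY κ h x g))))

open ProbabilityTheory

/-! ### Exponential moments and a Chernoff bound -/

theorem Real.exp_le_one_add_add_sq_mul_exp_abs (x : ℝ) :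
    Real.exp x ≤ 1 + x + x ^ 2 * Real.exp |x| := by
  have h := Complex.norm_exp_sub_sum_le_norm_mul_exp (x : ℂ) 2
  have h' : ‖Complex.exp (x : ℂ) - ∑ m ∈ Finset.range 2, (x : ℂ) ^ m / (m.factorial : ℂ)‖
      = |Real.exp x - (1 + x)| := by
    rw [← Real.norm_eq_abs, ← Complex.norm_real]
    simp [Finset.sum_range_succ]
  rw [h', Complex.norm_real, Real.norm_eq_abs, sq_abs] at h
  linarith [le_abs_self (Real.exp x - (1 + x))]

theorem integrable_exp_mul_abs_stdGaussian (t : ℝ) :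
    Integrable (fun g : ℝ => Real.exp (t * |g|)) (gaussianReal 0 1) :=
  integrable_exp_mul_abs (integrable_exp_mul_gaussianReal t) (integrable_exp_mul_gaussianReal (-t))

theorem integrable_abs_stdGaussian :
    Integrable (fun g : ℝ => |g|) (gaussianReal 0 1) := by
  have h := (memLp_id_gaussianReal (μ := 0) (v := 1) 1).integrable le_rfl
  exact h.abs

theorem integrable_of_abs_le_one_add_abs {X : ℝ → ℝ} (hX : Measurable X)
    (hb : ∀ g, |X g| ≤ 1 + |g|) : Integrable X (gaussianReal 0 1) :=
  ((integrable_const (1 : ℝ)).add integrable_abs_stdGaussian).mono' hX.aestronglyMeasurable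
    (Filter.Eventually.of_forall hb)

theorem integrable_exp_mul_of_abs_le_one_add_abs {X : ℝ → ℝ} (hX : Measurable X)
    (hb : ∀ g, |X g| ≤ 1 + |g|) {t : ℝ} (ht : 0 ≤ t) :
    Integrable (fun g => Real.exp (t * X g)) (gaussianReal 0 1) := by
  refine ((integrable_exp_mul_abs_stdGaussian t).const_mul (Real.exp t)).mono'
    (by fun_prop) (Filter.Eventually.of_forall fun g => ?_)
  rw [Real.norm_eq_abs, Real.abs_exp, ← Real.exp_add]
  gcongr
  nlinarith [le_abs_self (X g), hb g]

/-- Functions of a standard Gaussian which grow at most linearly and have mean at most `-m < 0`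
have uniformly small exponential moments. -/
theorem exists_integral_exp_mul_le {m : ℝ} (hm : 0 < m) :
    ∃ t : ℝ, 0 < t ∧ ∀ X : ℝ → ℝ, Measurable X → (∀ g, |X g| ≤ 1 + |g|) →
      ∫ g, X g ∂gaussianReal 0 1 ≤ -m →
      ∫ g, Real.exp (t * X g) ∂gaussianReal 0 1 ≤ Real.exp (-(t * m / 2)) := by
  have hG : Integrable (fun g : ℝ => 2 * Real.exp (2 * (1 + |g|))) (gaussianReal 0 1) := by
    refine ((integrable_exp_mul_abs_stdGaussian 2).const_mul (2 * Real.exp 2)).congr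
      (Filter.Eventually.of_forall fun g => ?_)
    simp only
    rw [mul_assoc, ← Real.exp_add]
    ring_nf
  set K : ℝ := ∫ g, 2 * Real.exp (2 * (1 + |g|)) ∂gaussianReal 0 1 with hK
  have hK0 : 0 ≤ K := integral_nonneg fun g => by positivity
  set t : ℝ := min 1 (m / (2 * (K + 1)))
  have ht : 0 < t := lt_min one_pos (by positivity)
  have ht1 : t ≤ 1 := min_le_left _ _
  have htK : t * K ≤ m / 2 := by
    have h : t * (2 * (K + 1)) ≤ m := (le_div_iff₀ (by positivity)).1 (min_le_right _ _)
    nlinarith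
  refine ⟨t, ht, fun X hX hb hmean => ?_⟩
  have hint := integrable_of_abs_le_one_add_abs hX hb
  have hlin : Integrable (fun g => 1 + t * X g) (gaussianReal 0 1) :=
    (integrable_const _).add (hint.const_mul t)
  have hpt : ∀ g, Real.exp (t * X g) ≤
      (1 + t * X g) + t ^ 2 * (2 * Real.exp (2 * (1 + |g|))) := by
    intro g
    have h1 := Real.exp_le_one_add_add_sq_mul_exp_abs (t * X g)
    have h0 : 0 ≤ 1 + |g| := by positivity
    have h2 : (X g) ^ 2 ≤ (1 + |g|) ^ 2 := sq_le_sq.2 (by rw [abs_of_nonneg h0]; exact hb g)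
    have h3 : |t * X g| ≤ 1 + |g| := by
      rw [abs_mul, abs_of_pos ht]
      nlinarith [hb g, abs_nonneg (X g)]
    have h4 : (1 + |g|) ^ 2 ≤ 2 * Real.exp (1 + |g|) := by
      nlinarith [Real.quadratic_le_exp_of_nonneg h0]
    have h5 : Real.exp (2 * (1 + |g|)) = Real.exp (1 + |g|) * Real.exp (1 + |g|) := by
      rw [← Real.exp_add]; ring_nf
    have h6 : (t * X g) ^ 2 * Real.exp |t * X g| ≤
        (t ^ 2 * (2 * Real.exp (1 + |g|))) * Real.exp (1 + |g|) := by
      rw [mul_pow]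
      gcongr
      exact h2.trans h4
    rw [h5]
    linarith
  calc ∫ g, Real.exp (t * X g) ∂gaussianReal 0 1
      ≤ ∫ g, ((1 + t * X g) + t ^ 2 * (2 * Real.exp (2 * (1 + |g|)))) ∂gaussianReal 0 1 :=
        integral_mono (integrable_exp_mul_of_abs_le_one_add_abs hX hb ht.le)
          (hlin.add (hG.const_mul _)) hpt
    _ = 1 + t * ∫ g, X g ∂gaussianReal 0 1 + t ^ 2 * K := by
        rw [integral_add hlin (hG.const_mul _),
          integral_add (integrable_const _) (hint.const_mul t), integral_const_mul,
          integral_const_mul, ← hK]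
        simp
    _ ≤ -(t * m / 2) + 1 := by nlinarith
    _ ≤ Real.exp (-(t * m / 2)) := Real.add_one_le_exp _

instance (d : ℕ) : IsProbabilityMeasure (stdGaussianPi d) := by
  unfold stdGaussianPi; infer_instance

theorem stdGaussianPi_real_sum_ge_le {d : ℕ} {X : Fin d → ℝ → ℝ} {t b : ℝ} (ht : 0 ≤ t)
    (hint : ∀ i, Integrable (fun g => Real.exp (t * X i g)) (gaussianReal 0 1))
    (hle : ∀ i, ∫ g, Real.exp (t * X i g) ∂gaussianReal 0 1 ≤ Real.exp (-b)) (s : ℝ) :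
    (stdGaussianPi d).real {g | s ≤ ∑ i, X i (g i)} ≤ Real.exp (-t * s - b * d) := by
  have hprod : (fun g : Fin d → ℝ => Real.exp (t * ∑ i, X i (g i))) =
      fun g => ∏ i, Real.exp (t * X i (g i)) := by
    ext g
    rw [Finset.mul_sum, Real.exp_sum]
  have hI : Integrable (fun g : Fin d → ℝ => Real.exp (t * ∑ i, X i (g i)))
      (stdGaussianPi d) := by
    rw [hprod]
    exact Integrable.fintype_prod_dep hint
  refine (measure_ge_le_exp_mul_mgf s ht hI).trans ?_
  rw [sub_eq_add_neg, Real.exp_add]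
  gcongr
  rw [mgf, hprod, stdGaussianPi, integral_fintype_prod_eq_prod (𝕜 := ℝ)
    (fun i g => Real.exp (t * X i g))]
  calc ∏ i, ∫ g, Real.exp (t * X i g) ∂gaussianReal 0 1
      ≤ ∏ _i : Fin d, Real.exp (-b) :=
        Finset.prod_le_prod (fun i _ => integral_nonneg fun g => (Real.exp_pos _).le)
          fun i _ => hle i
    _ = Real.exp (-(b * d)) := by
        rw [Finset.prod_const, Finset.card_univ, Fintype.card_fin, ← Real.exp_nat_mul]
        ring_nf

/-! ### Trigonometric moments of the standard Gaussian -/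

theorem integral_cexp_mul_I_stdGaussian (a : ℝ) :
    ∫ g : ℝ, Complex.exp (a * Complex.I * g) ∂gaussianReal 0 1 = Real.exp (-a ^ 2 / 2) := by
  have h := complexMGF_id_gaussianReal (μ := 0) (v := 1) (a * Complex.I)
  simp only [complexMGF, id] at h
  rw [h]
  push_cast
  congr 1
  rw [mul_pow, Complex.I_sq]
  simp

theorem integral_mul_cexp_mul_I_stdGaussian (a : ℝ) :
    ∫ g : ℝ, (g : ℂ) * Complex.exp (a * Complex.I * g) ∂gaussianReal 0 1 =
      a * Real.exp (-a ^ 2 / 2) * Complex.I := by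
  have h := hasDerivAt_complexMGF (X := id) (μ := gaussianReal 0 1) (z := a * Complex.I)
    (by simp [integrableExpSet_id_gaussianReal])
  have h' : HasDerivAt (complexMGF id (gaussianReal 0 1))
      (a * Complex.I * Complex.exp ((a * Complex.I) ^ 2 / 2)) (a * Complex.I) := by
    have : complexMGF id (gaussianReal 0 1) = fun z => Complex.exp (z ^ 2 / 2) := by
      ext z
      rw [complexMGF_id_gaussianReal]
      simp
    rw [this]
    have h2 := (((hasDerivAt_id (a * Complex.I : ℂ)).pow 2).div_const 2).cexp
    convert! h2 using 1
    simp only [id, Nat.cast_ofNat, Nat.add_one_sub_one, pow_one, Pi.pow_apply]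
    ring
  have := h.unique h'
  simp only [id] at this
  rw [this, mul_pow, Complex.I_sq]
  push_cast
  ring_nf

theorem integrable_cexp_mul_I_stdGaussian (a : ℝ) :
    Integrable (fun g : ℝ => Complex.exp (a * Complex.I * g)) (gaussianReal 0 1) := by
  refine (integrable_const (1 : ℝ)).mono' (by fun_prop) (Filter.Eventually.of_forall fun g => ?_)
  rw [show (a * Complex.I * g : ℂ) = ((a * g : ℝ) : ℂ) * Complex.I by push_cast; ring,
    Complex.norm_exp_ofReal_mul_I]

theorem integrable_mul_cexp_mul_I_stdGaussian (a : ℝ) :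
    Integrable (fun g : ℝ => (g : ℂ) * Complex.exp (a * Complex.I * g)) (gaussianReal 0 1) := by
  refine integrable_abs_stdGaussian.mono' (by fun_prop) (Filter.Eventually.of_forall fun g => ?_)
  rw [norm_mul, show (a * Complex.I * g : ℂ) = ((a * g : ℝ) : ℂ) * Complex.I by push_cast; ring,
    Complex.norm_exp_ofReal_mul_I]
  simp

/-! ### The limiting drift of a single coordinate -/

/-- The rescaled log-acceptance contribution of a coordinate at rescaled position `u`, in the
limit where the gradient drift in the proposal is negligible. -/
def limitDrift (u g : ℝ) : ℝ :=
  -Real.cos u + Real.cos (u + √2 * g) + √2 / 2 * g * (Real.sin u + Real.sin (u + √2 * g))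

/-- An upper bound for the rescaled log-acceptance contribution of a coordinate. -/
def driftMajorant (u g : ℝ) : ℝ := limitDrift u g / 3 + (1 + |g|) / 500

theorem limitDrift_eq_re (u g : ℝ) :
    limitDrift u g = -Real.cos u + √2 / 2 * Real.sin u * g +
      (Complex.exp (u * Complex.I) * (Complex.exp ((√2 : ℝ) * Complex.I * g) -
        (√2 / 2 : ℝ) * Complex.I * (g * Complex.exp ((√2 : ℝ) * Complex.I * g)))).re := by
  have h : ((√2 : ℝ) * Complex.I * g : ℂ) = ((√2 * g : ℝ) : ℂ) * Complex.I := by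
    push_cast; ring
  rw [h, limitDrift, Real.cos_add, Real.sin_add]
  simp only [Complex.mul_re, Complex.sub_re, Complex.sub_im, Complex.mul_im,
    Complex.exp_ofReal_mul_I_re, Complex.exp_ofReal_mul_I_im, Complex.ofReal_re,
    Complex.ofReal_im, Complex.I_re, Complex.I_im]
  ring

theorem integral_limitDrift (u : ℝ) :
    ∫ g, limitDrift u g ∂gaussianReal 0 1 = -Real.cos u * (1 - 2 * Real.exp (-1)) := by
  have hi1 := integrable_cexp_mul_I_stdGaussian (√2)
  have hi2 := (integrable_mul_cexp_mul_I_stdGaussian (√2)).const_mul ((√2 / 2 : ℝ) * Complex.I)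
  have hid : Integrable (fun g : ℝ => g) (gaussianReal 0 1) :=
    (memLp_id_gaussianReal (μ := 0) (v := 1) 1).integrable le_rfl
  have hlin : Integrable (fun g : ℝ => -Real.cos u + √2 / 2 * Real.sin u * g)
      (gaussianReal 0 1) := (integrable_const _).add (hid.const_mul _)
  have hF := (hi1.sub hi2).const_mul (Complex.exp (u * Complex.I))
  have hre := integral_re hF
  simp only [RCLike.re_to_complex, Pi.sub_apply] at hre hF
  have hFre := hF.re
  simp only [RCLike.re_to_complex] at hFre
  simp_rw [limitDrift_eq_re]
  rw [integral_add hlin hFre,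
    integral_add (integrable_const _) (hid.const_mul _), integral_const_mul,
    integral_id_gaussianReal, hre, integral_const_mul, integral_sub hi1 hi2, integral_const_mul,
    integral_cexp_mul_I_stdGaussian, integral_mul_cexp_mul_I_stdGaussian]
  have h2 : √2 * √2 = 2 := Real.mul_self_sqrt (by norm_num)
  have h3 : -√2 ^ 2 / 2 = -1 := by rw [sq, h2]; norm_num
  rw [h3]
  simp only [Complex.mul_re, Complex.sub_re, Complex.sub_im, Complex.mul_im,
    Complex.exp_ofReal_mul_I_re, Complex.exp_ofReal_mul_I_im, Complex.ofReal_re,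
    Complex.ofReal_im, Complex.I_re, Complex.I_im]
  simp
  linear_combination (Real.cos u * Real.exp (-1) / 2) * h2

theorem integral_abs_stdGaussian_le_one : ∫ g : ℝ, |g| ∂gaussianReal 0 1 ≤ 1 := by
  have hsq : Integrable (fun g : ℝ => g ^ 2) (gaussianReal 0 1) :=
    (memLp_id_gaussianReal (μ := 0) (v := 1) 2).integrable_sq
  have hv : ∫ g : ℝ, g ^ 2 ∂gaussianReal 0 1 = 1 := by
    have h := variance_fun_id_gaussianReal (μ := 0) (v := 1)
    rw [variance_of_integral_eq_zero (by fun_prop) (integral_id_gaussianReal ..)] at h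
    simpa using h
  calc ∫ g : ℝ, |g| ∂gaussianReal 0 1
      ≤ ∫ g : ℝ, (1 / 2 + 1 / 2 * g ^ 2) ∂gaussianReal 0 1 := by
        refine integral_mono integrable_abs_stdGaussian
          ((integrable_const _).add (hsq.const_mul _)) fun g => ?_
        simp only
        nlinarith [sq_nonneg (|g| - 1), sq_abs g]
    _ = 1 := by
        rw [integral_add (integrable_const _) (hsq.const_mul _), integral_const_mul, hv]
        simp; norm_num

theorem measurable_driftMajorant (u : ℝ) : Measurable (driftMajorant u) := by
  unfold driftMajorant limitDrift
  fun_prop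

theorem sqrt_two_le : √2 ≤ 3 / 2 := by
  rw [Real.sqrt_le_left (by norm_num)]; norm_num

theorem abs_limitDrift_le (u g : ℝ) : |limitDrift u g| ≤ 2 + √2 * |g| := by
  have h1 := Real.abs_cos_le_one u
  have h2 := Real.abs_cos_le_one (u + √2 * g)
  have h3 : |Real.sin u + Real.sin (u + √2 * g)| ≤ 2 :=
    (abs_add_le _ _).trans (by linarith [Real.abs_sin_le_one u, Real.abs_sin_le_one (u + √2 * g)])
  have h4 : |√2 / 2 * g * (Real.sin u + Real.sin (u + √2 * g))| ≤ √2 / 2 * |g| * 2 := by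
    rw [abs_mul, abs_mul, abs_of_nonneg (by positivity : 0 ≤ √2 / 2)]
    gcongr
  unfold limitDrift
  rw [abs_le] at *
  constructor <;> linarith

theorem abs_driftMajorant_le (u g : ℝ) : |driftMajorant u g| ≤ 1 + |g| := by
  have h := abs_limitDrift_le u g
  have h2 := mul_le_mul_of_nonneg_right sqrt_two_le (abs_nonneg g)
  have h3 := abs_nonneg g
  unfold driftMajorant
  rw [abs_le] at *
  constructor <;> linarith

theorem integral_driftMajorant_le {u : ℝ} (hu : 1 / 10 ≤ Real.cos u) :
    ∫ g, driftMajorant u g ∂gaussianReal 0 1 ≤ -(1 / 250) := by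
  have hd : Integrable (limitDrift u) (gaussianReal 0 1) := by
    refine (((integrable_const (2 : ℝ)).add (integrable_abs_stdGaussian.const_mul (√2))).mono'
      ?_ (Filter.Eventually.of_forall fun g => abs_limitDrift_le u g))
    unfold limitDrift
    fun_prop
  have hc : Integrable (fun g : ℝ => 1 + |g|) (gaussianReal 0 1) :=
    (integrable_const (1 : ℝ)).add integrable_abs_stdGaussian
  unfold driftMajorant
  rw [integral_add (hd.div_const _) (hc.div_const _), integral_div, integral_div,
    integral_add (integrable_const _) integrable_abs_stdGaussian, integral_limitDrift]
  have he : Real.exp (-1) ≤ 0.37 := by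
    rw [Real.exp_neg, inv_le_comm₀ (Real.exp_pos _) (by norm_num)]
    refine le_trans ?_ Real.exp_one_gt_d9.le
    norm_num
  have := integral_abs_stdGaussian_le_one
  simp only [integral_const, probReal_univ, one_smul]
  nlinarith

/-! ### Deterministic comparison of one coordinate with its limiting drift -/

theorem scaled_logAccept_le {r u w v g : ℝ} (hr : 0 < r) (hr1 : r ≤ 1 / 10 ^ 5)
    (hw : w = 2 / 3 * u + Real.sin u / 3) (hrw : |r * w| ≤ 12)
    (hv : v = u - r ^ 2 * w + √2 * g) :
    r ^ 2 / 3 * (-Real.cos u + Real.cos v + (v - u) / 2 * (Real.sin u + Real.sin v)) +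
      r ^ 4 / 4 * (w ^ 2 - (2 / 3 * v + Real.sin v / 3) ^ 2) ≤ r ^ 2 * driftMajorant u g := by
  have hlip : ∀ a b : ℝ, |Real.sin a - Real.sin b| ≤ |a - b| := fun a b => by
    simpa [Real.dist_eq] using Real.lipschitzWith_sin.dist_le_mul a b
  have hlipc : ∀ a b : ℝ, |Real.cos a - Real.cos b| ≤ |a - b| := fun a b => by
    simpa [Real.dist_eq] using Real.lipschitzWith_cos.dist_le_mul a b
  have hg := abs_nonneg g
  have hs0 : 0 ≤ √2 := Real.sqrt_nonneg _
  have hsg : √2 * |g| ≤ 3 / 2 * |g| := mul_le_mul_of_nonneg_right sqrt_two_le hg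
  have hshift : |r ^ 2 * w| ≤ 12 * r := by
    rw [show r ^ 2 * w = r * (r * w) by ring, abs_mul, abs_of_pos hr]
    nlinarith
  set v₀ := u + √2 * g with hv₀
  have hvv : |v - v₀| ≤ 12 * r := by
    rw [show v - v₀ = -(r ^ 2 * w) by rw [hv, hv₀]; ring, abs_neg]
    exact hshift
  have hvu : |v - u| ≤ 12 * r + 3 / 2 * |g| := by
    rw [show v - u = -(r ^ 2 * w) + √2 * g by rw [hv]; ring]
    refine (abs_add_le _ _).trans ?_
    rw [abs_neg, abs_mul √2, abs_of_nonneg hs0]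
    linarith
  have hcos : Real.cos v - Real.cos v₀ ≤ 12 * r := (le_abs_self _).trans ((hlipc v v₀).trans hvv)
  have hsum : |Real.sin u + Real.sin v| ≤ 2 :=
    (abs_add_le _ _).trans (by linarith [Real.abs_sin_le_one u, Real.abs_sin_le_one v])
  have hA1 : -(r ^ 2 * w) / 2 * (Real.sin u + Real.sin v) ≤ 12 * r := by
    refine (le_abs_self _).trans ?_
    rw [abs_mul, abs_div, abs_neg, abs_two]
    nlinarith [abs_nonneg (r ^ 2 * w), abs_nonneg (Real.sin u + Real.sin v)]
  have hA2 : √2 * g / 2 * (Real.sin v - Real.sin v₀) ≤ 9 * r * |g| := by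
    refine (le_abs_self _).trans ?_
    rw [abs_mul, abs_div, abs_mul, abs_of_nonneg hs0, abs_two]
    have := (hlip v v₀).trans hvv
    calc √2 * |g| / 2 * |Real.sin v - Real.sin v₀| ≤ 3 / 2 * |g| / 2 * (12 * r) := by gcongr
      _ = 9 * r * |g| := by ring
  have hA : -Real.cos u + Real.cos v + (v - u) / 2 * (Real.sin u + Real.sin v) ≤
      limitDrift u g + 24 * r + 9 * r * |g| := by
    have : -Real.cos u + Real.cos v + (v - u) / 2 * (Real.sin u + Real.sin v) =
        limitDrift u g + (Real.cos v - Real.cos v₀) +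
        -(r ^ 2 * w) / 2 * (Real.sin u + Real.sin v) +
        √2 * g / 2 * (Real.sin v - Real.sin v₀) := by
      rw [limitDrift, ← hv₀, show v - u = -(r ^ 2 * w) + √2 * g by rw [hv]; ring]
      ring
    linarith
  set δ := 2 / 3 * v + Real.sin v / 3 - w with hδ
  have hδ1 : |δ| ≤ 12 * r + 3 / 2 * |g| := by
    have h1 := (hlip v u).trans hvu
    rw [show δ = 2 / 3 * (v - u) + (Real.sin v - Real.sin u) / 3 by rw [hδ, hw]; ring]
    rw [abs_le] at *
    constructor <;> linarith
  have hB : r ^ 2 / 4 * (w ^ 2 - (2 / 3 * v + Real.sin v / 3) ^ 2) ≤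
      6 * r * (12 * r + 3 / 2 * |g|) := by
    have h1 : r ^ 2 / 4 * (w ^ 2 - (2 / 3 * v + Real.sin v / 3) ^ 2) ≤
        r / 2 * (-(r * w) * δ) := by
      rw [show 2 / 3 * v + Real.sin v / 3 = w + δ by rw [hδ]; ring]
      nlinarith [sq_nonneg (r * δ)]
    have h2 : -(r * w) * δ ≤ 12 * (12 * r + 3 / 2 * |g|) := by
      refine (le_abs_self _).trans ?_
      rw [abs_mul, abs_neg]
      gcongr
    nlinarith
  have hfin : (-Real.cos u + Real.cos v + (v - u) / 2 * (Real.sin u + Real.sin v)) / 3 +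
      r ^ 2 / 4 * (w ^ 2 - (2 / 3 * v + Real.sin v / 3) ^ 2) ≤ driftMajorant u g := by
    unfold driftMajorant
    nlinarith
  nlinarith [mul_le_mul_of_nonneg_left hfin (sq_nonneg r)]

theorem one_tenth_le_cos {u : ℝ} (k : ℤ) (h1 : -(9 / 20) * Real.pi + 2 * Real.pi * k ≤ u)
    (h2 : u ≤ 9 / 20 * Real.pi + 2 * Real.pi * k) : 1 / 10 ≤ Real.cos u := by
  have hpi := Real.pi_pos
  rw [← Real.cos_sub_int_mul_two_pi u k, ← Real.cos_abs]
  have h3 : |u - k * (2 * Real.pi)| ≤ 9 / 20 * Real.pi := by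
    rw [abs_le]; constructor <;> linarith
  refine le_trans ?_ (Real.cos_le_cos_of_nonneg_of_le_pi (abs_nonneg _) (by linarith) h3)
  rw [show 9 / 20 * Real.pi = Real.pi / 2 - Real.pi / 20 by ring, Real.cos_pi_div_two_sub]
  refine le_trans (le_of_eq ?_) (Real.mul_le_sin (by positivity) (by linarith))
  field_simp
  norm_num

theorem abs_mul_le_of_mem_window {r u : ℝ} (hr : 0 < r) (hr1 : r ≤ 1) (k : ℤ)
    (hk : |k| ≤ ⌊5 / (Real.pi * r)⌋) (h1 : -(9 / 20) * Real.pi + 2 * Real.pi * k ≤ u)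
    (h2 : u ≤ 9 / 20 * Real.pi + 2 * Real.pi * k) : |r * u| ≤ 12 := by
  have hpi := Real.pi_pos
  have hpi4 := Real.pi_le_four
  have hk' : |(k : ℝ)| ≤ 5 / (Real.pi * r) := by
    have := (Int.cast_le (R := ℝ)).2 hk
    rw [Int.cast_abs] at this
    exact this.trans (Int.floor_le _)
  rw [le_div_iff₀ (by positivity)] at hk'
  have h3 : |u| ≤ 9 / 20 * Real.pi + 2 * Real.pi * |(k : ℝ)| := by
    rw [abs_le]
    constructor <;> nlinarith [le_abs_self (k : ℝ), neg_abs_le (k : ℝ)]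
  rw [abs_mul, abs_of_pos hr]
  nlinarith [mul_le_mul_of_nonneg_left h3 hr.le]

/-! ### The coordinates of the log-acceptance ratio -/

section Coordinates

variable {d : ℕ} [NeZero d] {κ h : ℝ}

/-- The contribution of coordinate `i` to the log-acceptance ratio for the move `a ↦ b`. -/
def coordLogAccept (κ h : ℝ) (i : Fin d) (a b : ℝ) : ℝ :=
  fhard1d κ h i a - fhard1d κ h i b +
    (1 / (4 * h)) * ((b - (a - h * deriv (fhard1d κ h i) a)) ^ 2 -
      (a - (b - h * deriv (fhard1d κ h i) b)) ^ 2)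

theorem logAccept_eq_sum (x g : Fin d → ℝ) :
    logAccept κ h x g = ∑ i, coordLogAccept κ h i (x i) (malaY κ h x g i) := by
  simp only [logAccept, fhard, sqNorm, coordLogAccept, gradFhard, Finset.sum_add_distrib,
    Finset.sum_sub_distrib, ← Finset.mul_sum, Pi.sub_apply, Pi.smul_apply, smul_eq_mul]

theorem deriv_fhard1d_zero (a : ℝ) : deriv (fhard1d κ h (0 : Fin d)) a = a := by
  have h1 : HasDerivAt (fhard1d κ h (0 : Fin d)) ((1 / 2) * (2 * a)) a := by
    have h2 := (hasDerivAt_pow 2 a).const_mul (1 / 2 : ℝ)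
    have h3 : fhard1d κ h (0 : Fin d) = fun c => 1 / 2 * c ^ 2 := by
      ext c; simp [fhard1d]
    rw [h3]
    simpa using h2
  rw [h1.deriv]; ring

theorem deriv_fhard1d_of_ne {i : Fin d} (hi : i ≠ 0) (a : ℝ) :
    deriv (fhard1d κ h i) a =
      2 * κ / 3 * a + κ * h / 3 * (Real.sin (a / √h) / √h) := by
  have h1 : HasDerivAt (fhard1d κ h i)
      (κ / 3 * (2 * a) - κ * h / 3 * (-Real.sin (a / √h) * (1 / √h))) a := by
    have h2 := ((hasDerivAt_id a).div_const (√h)).cos.const_mul (κ * h / 3)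
    have h3 := (hasDerivAt_pow 2 a).const_mul (κ / 3)
    have h4 : fhard1d κ h i = fun c => κ / 3 * c ^ 2 - κ * h / 3 * Real.cos (c / √h) := by
      ext c; simp [fhard1d, hi]
    rw [h4]
    convert! h3.sub h2 using 1
    simp
  rw [h1.deriv]; ring

theorem coordLogAccept_zero_le (hh : 0 < h) {a : ℝ} (ha : |a| ≤ 2) (b : ℝ) :
    coordLogAccept κ h (0 : Fin d) a b ≤ h := by
  have ha2 : a ^ 2 ≤ 4 := by nlinarith [sq_abs a, abs_nonneg a]
  have : coordLogAccept κ h (0 : Fin d) a b = h / 4 * (a ^ 2 - b ^ 2) := by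
    simp only [coordLogAccept, deriv_fhard1d_zero, fhard1d, if_pos]
    field_simp
    ring
  rw [this]
  nlinarith [sq_nonneg b]

theorem coordLogAccept_le_of_ne (hκ : 0 < κ) (hh : 0 < h) (hκh : h * κ ≤ (1 / 10 ^ 5) ^ 2)
    {x : Fin d → ℝ} (hx : x ∈ OmegaHard d κ h) {i : Fin d} (hi : i ≠ 0) (g : Fin d → ℝ) :
    coordLogAccept κ h i (x i) (malaY κ h x g i) ≤
      h * κ * driftMajorant (x i / √h) (g i) := by
  obtain ⟨k, hk, h1, h2⟩ := hx.2 i hi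
  set r := √(h * κ) with hr_def
  have hr : 0 < r := Real.sqrt_pos.2 (by positivity)
  have hr2 : r ^ 2 = h * κ := Real.sq_sqrt (by positivity)
  have hr1 : r ≤ 1 / 10 ^ 5 := by
    rw [hr_def, Real.sqrt_le_left (by positivity)]; exact hκh
  set s := √h with hs_def
  have hs : 0 < s := Real.sqrt_pos.2 hh
  have hs2 : s ^ 2 = h := Real.sq_sqrt hh.le
  set u := x i / s with hu_def
  have hxu : x i = s * u := by rw [hu_def]; field_simp
  have h1' : -(9 / 20) * Real.pi + 2 * Real.pi * k ≤ u := by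
    rw [hu_def, le_div_iff₀ hs]; linarith
  have h2' : u ≤ 9 / 20 * Real.pi + 2 * Real.pi * k := by
    rw [hu_def, div_le_iff₀ hs]; linarith
  have hru := abs_mul_le_of_mem_window hr (hr1.trans (by norm_num)) k hk h1' h2'
  have hrw : |r * (2 / 3 * u + Real.sin u / 3)| ≤ 12 := by
    rw [abs_mul, abs_of_pos hr] at *
    have hle : |2 / 3 * u + Real.sin u / 3| ≤ |u| := by
      have h3 : |Real.sin u| ≤ |u| := Real.abs_sin_le_abs
      refine (abs_add_le _ _).trans ?_
      rw [abs_mul, abs_of_pos (by norm_num : (0 : ℝ) < 2 / 3), abs_div (Real.sin u),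
        abs_of_pos (by norm_num : (0 : ℝ) < 3)]
      linarith
    exact (mul_le_mul_of_nonneg_left hle hr.le).trans hru
  set w := 2 / 3 * u + Real.sin u / 3 with hw_def
  set v := u - r ^ 2 * w + √2 * g i with hv_def
  have hy : malaY κ h x g i = s * v := by
    simp only [malaY, gradFhard, Pi.add_apply, Pi.sub_apply, Pi.smul_apply, smul_eq_mul,
      deriv_fhard1d_of_ne hi]
    rw [← hs_def, ← hu_def, hxu, hv_def, hr2, hw_def, Real.sqrt_mul (by norm_num), ← hs_def]
    field_simp
    rw [← hs2]
    ring
  refine le_trans (le_of_eq ?_)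
    ((scaled_logAccept_le hr hr1 hw_def hrw hv_def).trans_eq (by rw [hr2]))
  have hsu : s * u / s = u := by field_simp
  have hsv : s * v / s = v := by field_simp
  rw [show r ^ 4 = (r ^ 2) ^ 2 by ring, hr2, hy, hxu]
  simp only [coordLogAccept, deriv_fhard1d_of_ne hi, fhard1d, if_neg hi]
  rw [← hs_def, hsu, hsv, hw_def, ← hs2]
  field_simp
  ring

end Coordinates

theorem exists_exp_neg_mul_le {b : ℝ} (hb : 0 < b) :
    ∃ n₀ : ℕ, ∀ n : ℕ, n₀ ≤ n → Real.exp (-b * n) ≤ 2 * ((n : ℝ) ^ 5)⁻¹ := by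
  have h := (tendsto_rpow_mul_exp_neg_mul_atTop_nhds_zero 5 b hb).comp
    tendsto_natCast_atTop_atTop
  obtain ⟨n₀, hn₀⟩ := Filter.eventually_atTop.1 (h.eventually_le_const zero_lt_two)
  refine ⟨n₀ + 1, fun n hn => ?_⟩
  have h1 := hn₀ n (by omega)
  have hpos : (0 : ℝ) < (n : ℝ) ^ 5 := by
    have : 0 < n := by omega
    positivity
  rw [← div_eq_mul_inv, le_div_iff₀ hpos]
  have h5 : ((n : ℝ) ^ (5 : ℝ)) = (n : ℝ) ^ 5 := by
    exact_mod_cast Real.rpow_natCast (n : ℝ) 5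
  simp only [Function.comp_apply, h5] at h1
  linarith

theorem hard_accept_bound :
    ∃ c : ℝ, 0 < c ∧ ∃ c' : ℝ, 0 < c' ∧ ∃ d₀ : ℕ,
      ∀ (d : ℕ) [NeZero d], d₀ ≤ d → ∀ κ : ℝ, 10 ≤ κ →
        ∀ h : ℝ, 0 < h → h ≤ c / (κ * Real.log d) →
          ∀ x ∈ OmegaHard d κ h,
            ENNReal.ofReal (1 - 2 * ((d : ℝ) ^ 5)⁻¹) ≤
              stdGaussianPi d {g : Fin d → ℝ |
                logAccept κ h x g ≤ -(c' * h * κ * d)} := by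
  obtain ⟨t, ht, hmgf⟩ := exists_integral_exp_mul_le (m := 1 / 250) (by norm_num)
  obtain ⟨n₀, hn₀⟩ := exists_exp_neg_mul_le (b := t * (1 / 250) / 4) (by positivity)
  refine ⟨(1 / 10 ^ 5) ^ 2, by positivity, 1 / 2000, by norm_num, max n₀ 1000, ?_⟩
  intro d _ hd κ hκ h hh hhc x hx
  have hd1 : 1000 ≤ d := (le_max_right _ _).trans hd
  have hd1' : (1000 : ℝ) ≤ d := by exact_mod_cast hd1
  have hlog : 1 ≤ Real.log d := by
    rw [Real.le_log_iff_exp_le (by linarith)]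
    linarith [Real.exp_one_lt_d9]
  have hκ0 : 0 < κ := by linarith
  have hκh : h * κ ≤ (1 / 10 ^ 5) ^ 2 := by
    rw [le_div_iff₀ (by positivity)] at hhc
    nlinarith [mul_pos hh hκ0]
  let X : Fin d → ℝ → ℝ := fun i =>
    if i = 0 then fun _ => -(1 / 250) else driftMajorant (x i / √h)
  have hXm : ∀ i, Measurable (X i) := fun i => by
    by_cases hi : i = 0
    · simp only [X, if_pos hi]; fun_prop
    · simp only [X, if_neg hi]; exact measurable_driftMajorant _
  have hXb : ∀ i g, |X i g| ≤ 1 + |g| := fun i g => by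
    by_cases hi : i = 0
    · simp only [X, if_pos hi]
      rw [abs_neg, abs_of_pos (by norm_num)]
      linarith [abs_nonneg g]
    · simp only [X, if_neg hi]; exact abs_driftMajorant_le _ _
  have hXi : ∀ i, ∫ g, X i g ∂gaussianReal 0 1 ≤ -(1 / 250) := fun i => by
    by_cases hi : i = 0
    · simp [X, if_pos hi]
    · simp only [X, if_neg hi]
      obtain ⟨k, -, h1, h2⟩ := hx.2 i hi
      have hs : 0 < √h := Real.sqrt_pos.2 hh
      refine integral_driftMajorant_le (one_tenth_le_cos k ?_ ?_)
      · rw [le_div_iff₀ hs]; linarith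
      · rw [div_le_iff₀ hs]; linarith
  have htail := stdGaussianPi_real_sum_ge_le ht.le
    (fun i => integrable_exp_mul_of_abs_le_one_add_abs (hXm i) (hXb i) ht.le)
    (fun i => hmgf (X i) (hXm i) (hXb i) (hXi i)) (-(d / 1000))
  rw [show -t * -((d : ℝ) / 1000) - t * (1 / 250) / 2 * d = -(t * (1 / 250) / 4) * d by ring]
    at htail
  set E : Set (Fin d → ℝ) := {g | -((d : ℝ) / 1000) ≤ ∑ i, X i (g i)} with hE
  have hEm : MeasurableSet E := by
    refine measurableSet_le measurable_const (Finset.measurable_sum _ fun i _ => ?_)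
    exact (hXm i).comp (measurable_pi_apply i)
  have hsub : Eᶜ ⊆ {g : Fin d → ℝ | logAccept κ h x g ≤ -(1 / 2000 * h * κ * d)} := by
    intro g hg
    simp only [hE, Set.mem_compl_iff, Set.mem_ofPred_eq, not_le] at hg ⊢
    have hhκ : 0 < h * κ := by positivity
    have hcoord : ∀ i, coordLogAccept κ h i (x i) (malaY κ h x g i) ≤
        h * κ * X i (g i) + if i = 0 then h * κ * (1 / 5) else 0 := fun i => by
      by_cases hi : i = 0
      · subst hi
        simp only [X, if_true]
        have := coordLogAccept_zero_le (d := d) (κ := κ) hh hx.1 (malaY κ h x g 0)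
        nlinarith
      · simp only [X, if_neg hi, add_zero]
        exact coordLogAccept_le_of_ne hκ0 hh hκh hx hi g
    have hsum := Finset.sum_le_sum fun i (_ : i ∈ Finset.univ) => hcoord i
    rw [← logAccept_eq_sum, Finset.sum_add_distrib, ← Finset.mul_sum,
      Finset.sum_ite_eq' Finset.univ (0 : Fin d), if_pos (Finset.mem_univ _)] at hsum
    nlinarith [mul_lt_mul_of_pos_left hg hhκ]
  refine le_trans ?_ (measure_mono hsub)
  rw [← ofReal_measureReal, probReal_compl_eq_one_sub hEm]
  refine ENNReal.ofReal_le_ofReal ?_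
  have := hn₀ d ((le_max_left _ _).trans hd)
  linarith
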